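/- Let k ≥ 3 be a positive integer. Then there is a constant δ = δ(k) > 0 such that for M = M(n) = 2⌊n^{2−2/(k+1)}⌋, a random graph G ~ G(T_{n,k}, M) asymptotically almost surely satisfies the following property: every subgraph of G with at least ⌊(1−δ)M⌋ edges contains a good copy of K_k. -/

import Mathlib

namespace TournamentGame

variable {V : Type*} [DecidableEq V]

/-- The underlying undirected edges of a set of oriented edges. -/
def undirect (M : Finset (V × V)) : Finset (Sym2 V) :=
  M.image fun p => s(p.1, p.2)

/-- `MakerWin X F b M B` : in the (1:b) Maker-Breaker game on board `X`, with Maker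
having claimed `M`, Breaker having claimed `B`, and Maker to move, Maker has a strategy
to claim all edges of some winning set (i.e. reach a position with `F` on her edges). -/
inductive MakerWin (X : Finset (Sym2 V)) (F : Finset (Sym2 V) → Prop) (b : ℕ) :
    Finset (Sym2 V) → Finset (Sym2 V) → Prop
  | win (M B : Finset (Sym2 V)) : F M → MakerWin X F b M B
  | move (M B : Finset (Sym2 V)) (e : Sym2 V) (heX : e ∈ X) (hefree : e ∉ M ∪ B)
      (h : ∀ B' : Finset (Sym2 V), B' ⊆ X \ (insert e M ∪ B) →
        B'.card = min b (X \ (insert e M ∪ B)).card →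
        MakerWin X F b (insert e M) (B ∪ B')) :
      MakerWin X F b M B

/-- `BreakerBlock X F b M B` : Maker to move; Breaker has a strategy ensuring that `F`
never holds on Maker's edge set. -/
inductive BreakerBlock (X : Finset (Sym2 V)) (F : Finset (Sym2 V) → Prop) (b : ℕ) :
    Finset (Sym2 V) → Finset (Sym2 V) → Prop
  | step (M B : Finset (Sym2 V)) (hF : ¬ F M) (resp : Sym2 V → Finset (Sym2 V))
      (hsub : ∀ e ∈ X, e ∉ M ∪ B → resp e ⊆ X \ (insert e M ∪ B))
      (hcard : ∀ e ∈ X, e ∉ M ∪ B → (resp e).card = min b (X \ (insert e M ∪ B)).card)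
      (h : ∀ e ∈ X, e ∉ M ∪ B → BreakerBlock X F b (insert e M) (B ∪ resp e)) :
      BreakerBlock X F b M B

/-- Oriented (tournament-game) version of `MakerWin`: Maker claims an edge together with
an orientation; her position is a set of oriented edges. -/
inductive OMakerWin (X : Finset (Sym2 V)) (F : Finset (V × V) → Prop) (b : ℕ) :
    Finset (V × V) → Finset (Sym2 V) → Prop
  | win (M : Finset (V × V)) (B : Finset (Sym2 V)) : F M → OMakerWin X F b M B
  | move (M : Finset (V × V)) (B : Finset (Sym2 V)) (x y : V)
      (heX : s(x, y) ∈ X) (hefree : s(x, y) ∉ undirect M ∪ B)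
      (h : ∀ B' : Finset (Sym2 V), B' ⊆ X \ (insert s(x, y) (undirect M) ∪ B) →
        B'.card = min b (X \ (insert s(x, y) (undirect M) ∪ B)).card →
        OMakerWin X F b (insert (x, y) M) (B ∪ B')) :
      OMakerWin X F b M B

/-- Oriented version of `BreakerBlock`. -/
inductive OBreakerBlock (X : Finset (Sym2 V)) (F : Finset (V × V) → Prop) (b : ℕ) :
    Finset (V × V) → Finset (Sym2 V) → Prop
  | step (M : Finset (V × V)) (B : Finset (Sym2 V)) (hF : ¬ F M)
      (resp : V → V → Finset (Sym2 V))
      (hsub : ∀ x y : V, s(x, y) ∈ X → s(x, y) ∉ undirect M ∪ B →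
        resp x y ⊆ X \ (insert s(x, y) (undirect M) ∪ B))
      (hcard : ∀ x y : V, s(x, y) ∈ X → s(x, y) ∉ undirect M ∪ B →
        (resp x y).card = min b (X \ (insert s(x, y) (undirect M) ∪ B)).card)
      (h : ∀ x y : V, s(x, y) ∈ X → s(x, y) ∉ undirect M ∪ B →
        OBreakerBlock X F b (insert (x, y) M) (B ∪ resp x y)) :
      OBreakerBlock X F b M B

/-- Position with Breaker to move, in the unoriented game: Breaker can respond and
then keep blocking forever. -/
def BreakerTurn (X : Finset (Sym2 V)) (F : Finset (Sym2 V) → Prop) (b : ℕ)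
    (M B : Finset (Sym2 V)) : Prop :=
  ¬ F M ∧ ∃ B' : Finset (Sym2 V), B' ⊆ X \ (M ∪ B) ∧
    B'.card = min b (X \ (M ∪ B)).card ∧ BreakerBlock X F b M (B ∪ B')

/-- Position with Breaker to move, in the oriented game. -/
def OBreakerTurn (X : Finset (Sym2 V)) (F : Finset (V × V) → Prop) (b : ℕ)
    (M : Finset (V × V)) (B : Finset (Sym2 V)) : Prop :=
  ¬ F M ∧ ∃ B' : Finset (Sym2 V), B' ⊆ X \ (undirect M ∪ B) ∧
    B'.card = min b (X \ (undirect M ∪ B)).card ∧ OBreakerBlock X F b M (B ∪ B')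

/-- Winning sets of the triangle game. -/
def HasTriangle (M : Finset (Sym2 V)) : Prop :=
  ∃ x y z : V, x ≠ y ∧ y ≠ z ∧ x ≠ z ∧ s(x, y) ∈ M ∧ s(y, z) ∈ M ∧ s(x, z) ∈ M

/-- Maker's oriented edges contain a cyclic (directed) triangle. -/
def HasCyclicTriangle (M : Finset (V × V)) : Prop :=
  ∃ x y z : V, x ≠ y ∧ y ≠ z ∧ x ≠ z ∧ (x, y) ∈ M ∧ (y, z) ∈ M ∧ (z, x) ∈ M

/-- Maker's oriented edges contain an acyclic (transitive) triangle. -/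
def HasAcyclicTriangle (M : Finset (V × V)) : Prop :=
  ∃ x y z : V, x ≠ y ∧ y ≠ z ∧ x ≠ z ∧ (x, y) ∈ M ∧ (y, z) ∈ M ∧ (x, z) ∈ M

/-- A tournament on `Fin k`, given by its arc relation. -/
def IsTournament {k : ℕ} (T : Fin k → Fin k → Prop) : Prop :=
  (∀ i, ¬ T i i) ∧ ∀ i j : Fin k, i ≠ j → (T i j ↔ ¬ T j i)

/-- Maker's oriented edges contain a copy of the tournament `T`. -/
def HasTCopy {k : ℕ} (T : Fin k → Fin k → Prop) (M : Finset (V × V)) : Prop :=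
  ∃ f : Fin k → V, Function.Injective f ∧ ∀ i j : Fin k, T i j → (f i, f j) ∈ M

/-- The edge set of the complete graph `K_n`. -/
def completeEdges (n : ℕ) : Finset (Sym2 (Fin n)) :=
  Finset.univ.filter fun e => ¬ e.IsDiag

/-- The edge set of the Turán graph `T_{n,k}` : classes are residues mod `k`. -/
def turanEdges (n k : ℕ) : Finset (Sym2 (Fin n)) :=
  Finset.univ.filter fun e => ¬ (e.map fun v : Fin n => v.val % k).IsDiag

/-- `A` contains a good copy of `K_k` (all vertices in distinct classes of `T_{n,k}`). -/
def GoodCopy (n k : ℕ) (A : Finset (Sym2 (Fin n))) : Prop :=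
  ∃ f : Fin k → Fin n, Function.Injective f ∧
    (∀ i j : Fin k, i ≠ j → (f i).val % k ≠ (f j).val % k) ∧
    (∀ i j : Fin k, i ≠ j → s(f i, f j) ∈ A)

open Classical in
/-- Probability that a `p`-random subset `A` of `E` (each element kept independently with
probability `p`) satisfies `P`. This is the model `G(E, p)`. -/
noncomputable def edgeProb {α : Type*} [DecidableEq α] (E : Finset α) (p : ℝ)
    (P : Finset α → Prop) : ℝ :=
  ∑ A ∈ E.powerset, if P A then p ^ A.card * (1 - p) ^ (E.card - A.card) else 0

open Classical in
/-- Probability that a uniformly random `M`-element subset of `E` satisfies `P`.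
This is the model `G(E, M)`. -/
noncomputable def uniformProb {α : Type*} [DecidableEq α] (E : Finset α) (M : ℕ)
    (P : Finset α → Prop) : ℝ :=
  ((E.powerset.filter fun A => A.card = M ∧ P A).card : ℝ) /
    ((E.powerset.filter fun A => A.card = M).card : ℝ)

/-- The three edges of a triangle on `x`, `y`, `z`. -/
def triEdges (x y z : V) : Finset (Sym2 V) := {s(x, y), s(y, z), s(x, z)}

/-- `x`, `y`, `z` form a triangle of the graph with edge set `A`. -/
def IsTriangleIn (A : Finset (Sym2 V)) (x y z : V) : Prop :=
  x ≠ y ∧ y ≠ z ∧ x ≠ z ∧ s(x, y) ∈ A ∧ s(y, z) ∈ A ∧ s(x, z) ∈ A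

/-- The triangles of `A`, each recorded as its set of three edges: the vertex set of `T_A`. -/
def TriSets (A : Finset (Sym2 V)) : Set (Finset (Sym2 V)) :=
  {t | ∃ x y z : V, IsTriangleIn A x y z ∧ t = triEdges x y z}

/-- `C` is a triangle collection: every edge lies in a triangle and the graph `T_C` of
triangles (adjacent iff sharing an edge) is connected. -/
def IsTriangleCollection (C : Finset (Sym2 V)) : Prop :=
  (∀ e ∈ C, ∃ x y z : V, IsTriangleIn C x y z ∧ e ∈ triEdges x y z) ∧
  ∀ t ∈ TriSets C, ∀ t' ∈ TriSets C,
    Relation.ReflTransGen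
      (fun a b => a ∈ TriSets C ∧ b ∈ TriSets C ∧ (a ∩ b).Nonempty) t t'

/-- Adjacency of `K₃⁺`: a triangle on `{0,1,2}` with a pendant edge `{2,3}`. -/
def K3plusAdj (a b : Fin 4) : Prop :=
  (a.val < 3 ∧ b.val < 3 ∧ a ≠ b) ∨ (a.val = 2 ∧ b.val = 3) ∨ (a.val = 3 ∧ b.val = 2)

/-- Adjacency of the path on `Fin m`. -/
def pathAdj {m : ℕ} (a b : Fin m) : Prop := a.val + 1 = b.val ∨ b.val + 1 = a.val

/-- `C` is very basic: `T_C` is (isomorphic to) a subgraph of `K₃⁺` or of a path `P_m`. -/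
def VeryBasic (C : Finset (Sym2 V)) : Prop :=
  (∃ φ : TriSets C → Fin 4, Function.Injective φ ∧
    ∀ t t' : TriSets C, t ≠ t' → ((t : Finset (Sym2 V)) ∩ (t' : Finset (Sym2 V))).Nonempty →
      K3plusAdj (φ t) (φ t')) ∨
  (∃ m : ℕ, ∃ φ : TriSets C → Fin m, Function.Injective φ ∧
    ∀ t t' : TriSets C, t ≠ t' → ((t : Finset (Sym2 V)) ∩ (t' : Finset (Sym2 V))).Nonempty →
      pathAdj (φ t) (φ t'))

/-- `C` is basic: there are distinct edges `e₁, e₂` with `C - eᵢ` very basic for both. -/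
def Basic (C : Finset (Sym2 V)) : Prop :=
  ∃ e₁ ∈ C, ∃ e₂ ∈ C, e₁ ≠ e₂ ∧ VeryBasic (C.erase e₁) ∧ VeryBasic (C.erase e₂)

open Classical in
/-- The set of non-isolated vertices of the graph with edge set `C`. -/
noncomputable def support [Fintype V] (C : Finset (Sym2 V)) : Finset V :=
  Finset.univ.filter fun v => ∃ e ∈ C, v ∈ e

open Classical in
/-- Degree of `v` in the graph with edge set `C`. -/
noncomputable def degreeIn (C : Finset (Sym2 V)) (v : V) : ℕ :=
  (C.filter fun e => v ∈ e).card

/-- The maximum density `m(C) = max_{H ⊆ C} e(H)/v(H)` is (strictly) less than `r`. -/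
def MaxDensityLt [Fintype V] (C : Finset (Sym2 V)) (r : ℝ) : Prop :=
  ∀ D ⊆ C, D.Nonempty → (D.card : ℝ) / ((support D).card : ℝ) < r

/-- The edge set of the `k`-wheel: a cycle on `{0, …, k-1} ⊆ Fin (k+1)` together with
all edges to the center, the vertex `k`. -/
def wheelEdges (k : ℕ) : Finset (Sym2 (Fin (k + 1))) :=
  ((Finset.univ : Finset (Fin k)).image fun i =>
    s((⟨i.val, by have := i.2; omega⟩ : Fin (k + 1)),
      (⟨(i.val + 1) % k, by have := i.2; exact Nat.lt_succ_of_lt (Nat.mod_lt _ (by omega))⟩ :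
        Fin (k + 1)))) ∪
  ((Finset.univ : Finset (Fin k)).image fun i =>
    s((⟨i.val, by have := i.2; omega⟩ : Fin (k + 1)), (Fin.last k)))

/-- Expectation of `f A` for a `p`-random subset `A` of `E`. -/
noncomputable def binExp {α : Type*} (E : Finset α) (p : ℝ) (f : Finset α → ℝ) : ℝ :=
  ∑ A ∈ E.powerset, p ^ A.card * (1 - p) ^ (E.card - A.card) * f A

section binExp

variable {α : Type*} {E : Finset α} {p : ℝ} {f g : Finset α → ℝ}

lemma binExp_congr (h : ∀ A ⊆ E, f A = g A) : binExp E p f = binExp E p g :=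
  Finset.sum_congr rfl fun A hA => by rw [h A (Finset.mem_powerset.1 hA)]

lemma binExp_mono (hp₀ : 0 ≤ p) (hp₁ : p ≤ 1) (h : ∀ A ⊆ E, f A ≤ g A) :
    binExp E p f ≤ binExp E p g :=
  Finset.sum_le_sum fun A hA => mul_le_mul_of_nonneg_left (h A (Finset.mem_powerset.1 hA))
    (mul_nonneg (pow_nonneg hp₀ _) (pow_nonneg (sub_nonneg.2 hp₁) _))

lemma binExp_add : binExp E p (fun A => f A + g A) = binExp E p f + binExp E p g := by
  simp only [binExp, mul_add, Finset.sum_add_distrib]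

lemma binExp_sub : binExp E p (fun A => f A - g A) = binExp E p f - binExp E p g := by
  simp only [binExp, mul_sub, Finset.sum_sub_distrib]

lemma binExp_const_mul (c : ℝ) : binExp E p (fun A => c * f A) = c * binExp E p f := by
  simp only [binExp, Finset.mul_sum]
  exact Finset.sum_congr rfl fun A _ => by ring

lemma binExp_sum {ι : Type*} (s : Finset ι) (F : ι → Finset α → ℝ) :
    binExp E p (fun A => ∑ i ∈ s, F i A) = ∑ i ∈ s, binExp E p (F i) := by
  simp only [binExp, Finset.mul_sum]
  exact Finset.sum_comm

lemma binExp_insert [DecidableEq α] {e : α} (he : e ∉ E) (f : Finset α → ℝ) :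
    binExp (insert e E) p f = binExp E p fun A => (1 - p) * f A + p * f (insert e A) := by
  simp only [binExp]
  rw [Finset.sum_powerset_insert he, ← Finset.sum_add_distrib]
  refine Finset.sum_congr rfl fun A hA => ?_
  have hA' := Finset.mem_powerset.1 hA
  have hcard := Finset.card_le_card hA'
  rw [Finset.card_insert_of_notMem he, Finset.card_insert_of_notMem fun h => he (hA' h),
    show E.card + 1 - A.card = (E.card - A.card) + 1 by omega,
    show E.card + 1 - (A.card + 1) = E.card - A.card by omega]
  ring

lemma binExp_const (c : ℝ) : binExp E p (fun _ => c) = c := by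
  classical
  induction E using Finset.induction_on with
  | empty => simp [binExp]
  | insert e E he ih =>
    rw [binExp_insert he, show (1 - p) * c + p * c = c by ring, ih]

open Classical in
lemma edgeProb_eq_binExp [DecidableEq α] (P : Finset α → Prop) :
    edgeProb E p P = binExp E p fun A => if P A then 1 else 0 :=
  Finset.sum_congr rfl fun A _ => by rw [mul_ite, mul_one, mul_zero]

lemma binExp_ite_subset [DecidableEq α] {K : Finset α} (hK : K ⊆ E) :
    binExp E p (fun A => if K ⊆ A then 1 else 0) = p ^ K.card := by
  induction E using Finset.induction_on generalizing K with
  | empty => simp [binExp, Finset.subset_empty.1 hK]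
  | insert e E he ih =>
    rw [binExp_insert he]
    by_cases heK : e ∈ K
    · have hK' : K.erase e ⊆ E := Finset.subset_insert_iff.1 hK
      rw [← Finset.card_erase_add_one heK, pow_succ', ← ih hK', ← binExp_const_mul]
      refine binExp_congr fun A hA => ?_
      rw [if_neg fun h => he (hA (h heK))]
      simp [Finset.subset_insert_iff]
    · have hK' : K ⊆ E := (Finset.subset_insert_iff_of_notMem heK).1 hK
      rw [← ih hK']
      refine binExp_congr fun A _ => ?_
      simp only [Finset.subset_insert_iff_of_notMem heK]
      ring

lemma binExp_card : binExp E p (fun A => (A.card : ℝ)) = E.card * p := by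
  classical
  have h : ∀ A ⊆ E, (A.card : ℝ) = ∑ e ∈ E, if {e} ⊆ A then 1 else 0 := by
    intro A hA
    simp [Finset.inter_eq_right.2 hA]
  rw [binExp_congr h, binExp_sum,
    Finset.sum_congr rfl fun e he => binExp_ite_subset (Finset.singleton_subset_iff.2 he)]
  simp

/-- Efron–Stein variance bound for edge-Lipschitz functions. -/
lemma binExp_sq_le [DecidableEq α] (hp₀ : 0 ≤ p) (hp₁ : p ≤ 1)
    (hf : ∀ (e : α) (A : Finset α), |f (insert e A) - f A| ≤ 1) :
    binExp E p (fun A => f A ^ 2) ≤ binExp E p f ^ 2 + E.card * p := by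
  induction E using Finset.induction_on generalizing f with
  | empty => simp [binExp]
  | insert e E he ih =>
    have hg : ∀ (a : α) (A : Finset α),
        |((1 - p) * f (insert a A) + p * f (insert e (insert a A))) -
          ((1 - p) * f A + p * f (insert e A))| ≤ 1 := by
      intro a A
      have h₁ := abs_le.1 (hf a A)
      have h₂ := abs_le.1 (hf a (insert e A))
      rw [Finset.insert_comm a e] at h₂
      rw [abs_le]
      constructor <;> nlinarith
    have key : binExp E p (fun A => (1 - p) * f A ^ 2 + p * f (insert e A) ^ 2) ≤
        binExp E p (fun A => ((1 - p) * f A + p * f (insert e A)) ^ 2 + p) := by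
      refine binExp_mono hp₀ hp₁ fun A _ => ?_
      have h₁ : (f (insert e A) - f A) ^ 2 ≤ 1 := by
        rw [← sq_abs]
        exact pow_le_one₀ (abs_nonneg _) (hf e A)
      have h₂ : p * (1 - p) * (f (insert e A) - f A) ^ 2 ≤ p := by
        have : p * (1 - p) ≤ p := by nlinarith
        calc p * (1 - p) * (f (insert e A) - f A) ^ 2 ≤ p * (1 - p) * 1 :=
              mul_le_mul_of_nonneg_left h₁ (mul_nonneg hp₀ (sub_nonneg.2 hp₁))
          _ ≤ p := by linarith
      linarith [show (1 - p) * f A ^ 2 + p * f (insert e A) ^ 2 =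
        ((1 - p) * f A + p * f (insert e A)) ^ 2 + p * (1 - p) * (f (insert e A) - f A) ^ 2 by
          ring]
    rw [binExp_add (g := fun _ => p), binExp_const] at key
    rw [binExp_insert he, binExp_insert he, Finset.card_insert_of_notMem he]
    push_cast
    linarith [ih (f := fun A => (1 - p) * f A + p * f (insert e A)) hg]

open Classical in
/-- Chebyshev's inequality for the lower tail of an edge-Lipschitz function. -/
lemma edgeProb_le_half_le [DecidableEq α] (hp₀ : 0 ≤ p) (hp₁ : p ≤ 1)
    (hf : ∀ (e : α) (A : Finset α), |f (insert e A) - f A| ≤ 1) {μ : ℝ} (hμ : 0 < μ)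
    (hle : μ ≤ binExp E p f) :
    edgeProb E p (fun A => f A ≤ μ / 2) ≤ 4 * (E.card * p) / μ ^ 2 := by
  set m := binExp E p f with hm
  have h₂ : binExp E p (fun A => if f A ≤ μ / 2 then 1 else 0) ≤
      binExp E p (fun A => 4 / μ ^ 2 * ((f A ^ 2 - 2 * m * f A) + m ^ 2)) := by
    refine binExp_mono hp₀ hp₁ fun A _ => ?_
    rw [show (f A ^ 2 - 2 * m * f A) + m ^ 2 = (m - f A) ^ 2 by ring]
    split_ifs with h
    · rw [div_mul_eq_mul_div, le_div_iff₀ (by positivity)]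
      nlinarith
    · positivity
  rw [binExp_const_mul, binExp_add (g := fun _ => m ^ 2), binExp_sub, binExp_const_mul,
    binExp_const, ← hm] at h₂
  rw [edgeProb_eq_binExp, mul_div_right_comm]
  refine h₂.trans (mul_le_mul_of_nonneg_left ?_ (by positivity))
  have := binExp_sq_le (E := E) hp₀ hp₁ hf
  rw [← hm] at this
  linarith [show m ^ 2 - 2 * m * m + m ^ 2 = 0 by ring]

open Classical in
/-- A decreasing property has decreasing probability in the uniform model. -/
lemma uniformProb_mul_choose_le [DecidableEq α] {M m : ℕ} (hM : M ≤ E.card) (hm : m ≤ M)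
    {B : Finset α → Prop} (hB : ∀ A A', A' ⊆ A → B A → B A') :
    uniformProb E M B * (E.card.choose m : ℝ) ≤
      (((E.powersetCard m).filter B).card : ℝ) := by
  have hden : E.powerset.filter (fun A => A.card = M) = E.powersetCard M :=
    Finset.powersetCard_eq_filter.symm
  have hnum : E.powerset.filter (fun A => A.card = M ∧ B A) = (E.powersetCard M).filter B := by
    rw [← hden, Finset.filter_filter]
  have hcount : ((E.powersetCard M).filter B).card * M.choose m ≤
      ((E.powersetCard m).filter B).card * (E.card - m).choose (M - m) := by
    refine Finset.card_mul_le_card_mul (fun T S => S ⊆ T) (fun T hT => ?_) fun S hS => ?_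
    · obtain ⟨hT, hBT⟩ := Finset.mem_filter.1 hT
      obtain ⟨hTE, hTM⟩ := Finset.mem_powersetCard.1 hT
      rw [← hTM, ← Finset.card_powersetCard]
      refine Finset.card_le_card fun S hS => ?_
      obtain ⟨hST, hSm⟩ := Finset.mem_powersetCard.1 hS
      simp only [Finset.mem_bipartiteAbove, Finset.mem_filter, Finset.mem_powersetCard]
      exact ⟨⟨⟨hST.trans hTE, hSm⟩, hB T S hST hBT⟩, hST⟩
    · obtain ⟨hS, -⟩ := Finset.mem_filter.1 hS
      obtain ⟨hSE, hSm⟩ := Finset.mem_powersetCard.1 hS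
      rw [← hSm, ← Finset.card_filter_powersetCard_subset S E M hSE (hSm.trans_le hm)]
      refine Finset.card_le_card fun T hT => ?_
      obtain ⟨hT, hST⟩ := (Finset.mem_bipartiteBelow _).1 hT
      exact Finset.mem_filter.2 ⟨(Finset.mem_filter.1 hT).1, hST⟩
  have hpos : 0 < (E.card - m).choose (M - m) := Nat.choose_pos (by omega)
  have hposM : 0 < E.card.choose M := Nat.choose_pos hM
  have hmul := Nat.choose_mul (n := E.card) hm
  unfold uniformProb
  rw [hden, hnum, Finset.card_powersetCard, div_mul_eq_mul_div,
    div_le_iff₀ (by exact_mod_cast hposM)]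
  norm_cast
  refine Nat.le_of_mul_le_mul_right ?_ hpos
  calc _ = ((E.powersetCard M).filter B).card * M.choose m * E.card.choose M := by
        rw [mul_assoc, ← hmul]; ring
    _ ≤ _ := (Nat.mul_le_mul_right _ hcount).trans_eq (by ring)

/-- Transfer of decreasing properties from the binomial to the uniform model. -/
lemma uniformProb_le_two_mul_edgeProb [DecidableEq α] (hp₀ : 0 ≤ p) (hp₁ : p ≤ 1) {M : ℕ}
    (hM₀ : 0 < M) (hM : M ≤ E.card) (hpM : E.card * p ≤ M / 2)
    {B : Finset α → Prop} (hB : ∀ A A', A' ⊆ A → B A → B A') :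
    uniformProb E M B ≤ 2 * edgeProb E p B := by
  classical
  set u := uniformProb E M B with hu
  have hu₀ : 0 ≤ u := by unfold u uniformProb; positivity
  have hM₀' : (0 : ℝ) < M := by exact_mod_cast hM₀
  have h₁ : u * binExp E p (fun A => if A.card ≤ M then 1 else 0) ≤ edgeProb E p B := by
    rw [edgeProb_eq_binExp, ← binExp_const_mul]
    unfold binExp
    rw [Finset.sum_powerset, Finset.sum_powerset]
    refine Finset.sum_le_sum fun m _ => ?_
    have hcongr : ∀ F : Finset α → ℝ, ∑ A ∈ E.powersetCard m,
        p ^ A.card * (1 - p) ^ (E.card - A.card) * F A =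
          p ^ m * (1 - p) ^ (E.card - m) * ∑ A ∈ E.powersetCard m, F A := by
      intro F
      rw [Finset.mul_sum]
      exact Finset.sum_congr rfl fun A hA => by rw [(Finset.mem_powersetCard.1 hA).2]
    rw [hcongr, hcongr]
    refine mul_le_mul_of_nonneg_left ?_
      (mul_nonneg (pow_nonneg hp₀ _) (pow_nonneg (sub_nonneg.2 hp₁) _))
    by_cases hm : m ≤ M
    · rw [Finset.sum_congr rfl fun A hA => by
        rw [(Finset.mem_powersetCard.1 hA).2, if_pos hm]]
      have := uniformProb_mul_choose_le hM hm hB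
      simpa [mul_comm] using this
    · rw [Finset.sum_congr rfl fun A hA => by
        rw [(Finset.mem_powersetCard.1 hA).2, if_neg hm]]
      simp only [mul_zero, Finset.sum_const_zero]
      exact Finset.sum_nonneg fun A _ => by split_ifs <;> norm_num
  have h₂ : binExp E p (fun A => 1 - (M : ℝ)⁻¹ * A.card) ≤
      binExp E p (fun A => if A.card ≤ M then 1 else 0) := by
    refine binExp_mono hp₀ hp₁ fun A _ => ?_
    split_ifs with h
    · have : (0 : ℝ) ≤ (M : ℝ)⁻¹ * A.card := by positivity
      linarith
    · have : (1 : ℝ) ≤ (M : ℝ)⁻¹ * A.card := by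
        rw [inv_mul_eq_div, le_div_iff₀ hM₀', one_mul]
        exact_mod_cast (not_le.1 h).le
      linarith
  rw [binExp_sub, binExp_const, binExp_const_mul, binExp_card] at h₂
  have h₃ : (M : ℝ)⁻¹ * (E.card * p) ≤ 1 / 2 := by
    rw [inv_mul_eq_div, div_le_iff₀ hM₀']
    linarith
  nlinarith

end binExp

section uniformProb

variable {α : Type*} [DecidableEq α] {E : Finset α} {M : ℕ}

lemma uniformProb_le_one (P : Finset α → Prop) : uniformProb E M P ≤ 1 := by
  classical
  refine div_le_one_of_le₀ ?_ (Nat.cast_nonneg _)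
  exact_mod_cast Finset.card_le_card fun A hA => by
    rw [Finset.mem_filter] at hA ⊢
    exact ⟨hA.1, hA.2.1⟩

lemma one_sub_uniformProb_le (hM : M ≤ E.card) {B P : Finset α → Prop}
    (h : ∀ A ⊆ E, A.card = M → ¬ B A → P A) : 1 - uniformProb E M B ≤ uniformProb E M P := by
  classical
  have hpos : 0 < (E.powerset.filter fun A => A.card = M).card := by
    rw [← Finset.powersetCard_eq_filter, Finset.card_powersetCard]
    exact Nat.choose_pos hM
  unfold uniformProb
  rw [sub_le_iff_le_add, ← add_div, one_le_div (by exact_mod_cast hpos)]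
  norm_cast
  refine (Finset.card_le_card fun A hA => ?_).trans (Finset.card_union_le _ _)
  simp only [Finset.mem_filter, Finset.mem_powerset, Finset.mem_union] at hA ⊢
  have := h A hA.1 hA.2
  tauto

end uniformProb

section packing

variable {α ι : Type*} [DecidableEq α] [Fintype ι] (K : ι → Finset α)

open Classical in
/-- The largest number of pairwise disjoint members of the family `K` contained in `A`. -/
noncomputable def packing (A : Finset α) : ℕ :=
  (Finset.univ.filter fun F : Finset ι =>
    (F : Set ι).PairwiseDisjoint K ∧ ∀ i ∈ F, K i ⊆ A).sup Finset.card

variable {K} {A : Finset α}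

lemma card_le_packing {F : Finset ι} (hF : (F : Set ι).PairwiseDisjoint K)
    (hFA : ∀ i ∈ F, K i ⊆ A) : F.card ≤ packing K A := by
  classical
  exact Finset.le_sup (f := Finset.card) (Finset.mem_filter.2 ⟨Finset.mem_univ F, hF, hFA⟩)

lemma exists_card_eq_packing (K : ι → Finset α) (A : Finset α) :
    ∃ F : Finset ι, (F : Set ι).PairwiseDisjoint K ∧ (∀ i ∈ F, K i ⊆ A) ∧
      F.card = packing K A := by
  classical
  obtain ⟨F, hF, h⟩ := Finset.exists_mem_eq_sup (Finset.univ.filter fun F : Finset ι =>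
    (F : Set ι).PairwiseDisjoint K ∧ ∀ i ∈ F, K i ⊆ A) ⟨∅, by simp⟩ Finset.card
  exact ⟨F, (Finset.mem_filter.1 hF).2.1, (Finset.mem_filter.1 hF).2.2, h.symm⟩

lemma packing_mono : Monotone (packing K) := by
  intro A A' hA
  obtain ⟨F, hF, hFA, h⟩ := exists_card_eq_packing K A
  exact h ▸ card_le_packing hF fun i hi => (hFA i hi).trans hA

lemma packing_insert_le (e : α) (A : Finset α) : packing K (insert e A) ≤ packing K A + 1 := by
  classical
  obtain ⟨F, hF, hFA, h⟩ := exists_card_eq_packing K (insert e A)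
  have h₁ : (F.filter fun i => e ∈ K i).card ≤ 1 := by
    refine Finset.card_le_one.2 fun i hi j hj => ?_
    rw [Finset.mem_filter] at hi hj
    exact hF.elim_finset hi.1 hj.1 e hi.2 hj.2
  have h₂ : (F.filter fun i => e ∉ K i).card ≤ packing K A := by
    refine card_le_packing (hF.subset (Finset.coe_subset.2 (Finset.filter_subset _ F))) fun i hi => ?_
    rw [Finset.mem_filter] at hi
    exact (Finset.subset_insert_iff_of_notMem hi.2).1 (hFA i hi.1)
  have := Finset.card_filter_add_card_filter_not (s := F) fun i => e ∈ K i
  omega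

lemma abs_packing_insert_sub_le (e : α) (A : Finset α) :
    |(packing K (insert e A) : ℝ) - packing K A| ≤ 1 := by
  have h₁ : (packing K A : ℝ) ≤ packing K (insert e A) := by
    exact_mod_cast packing_mono (Finset.subset_insert e A)
  have h₂ : (packing K (insert e A) : ℝ) ≤ packing K A + 1 := by
    exact_mod_cast packing_insert_le e A
  rw [abs_le]
  constructor <;> linarith

/-- Deleting fewer elements than the packing number leaves a member of the family. -/
lemma exists_subset_of_card_sdiff_lt_packing {A' : Finset α}
    (h : (A \ A').card < packing K A) : ∃ i, K i ⊆ A' := by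
  obtain ⟨F, hF, hFA, hcard⟩ := exists_card_eq_packing K A
  by_contra! hno
  have hex : ∀ i, ∃ e, e ∈ K i ∧ e ∉ A' := fun i => Finset.not_subset.1 (hno i)
  choose g hg hg' using hex
  refine (h.trans_eq hcard.symm).not_ge (Finset.card_le_card_of_injOn g (fun i hi => ?_) ?_)
  · exact Finset.mem_coe.2 (Finset.mem_sdiff.2 ⟨hFA i hi (hg i), hg' i⟩)
  · intro i hi j hj hij
    exact hF.elim_finset hi hj (g i) (hg i) (hij ▸ hg j)

open Classical in
lemma sum_sub_sum_le_packing (A : Finset α) :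
    ∑ i, ((if K i ⊆ A then 1 else 0) -
      ∑ j with j ≠ i ∧ ¬ Disjoint (K i) (K j), if K i ∪ K j ⊆ A then (1 : ℝ) else 0) ≤
        packing K A := by
  set F : Finset ι := Finset.univ.filter fun i =>
    K i ⊆ A ∧ ∀ j, j ≠ i → ¬ Disjoint (K i) (K j) → ¬ K j ⊆ A with hF
  have hcard : F.card ≤ packing K A := by
    refine card_le_packing (fun i hi j hj hij => ?_) fun i hi => (Finset.mem_filter.1 hi).2.1
    by_contra hd
    exact (Finset.mem_filter.1 (Finset.mem_coe.1 hi)).2.2 j hij.symm hd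
      (Finset.mem_filter.1 (Finset.mem_coe.1 hj)).2.1
  have hsum : (F.card : ℝ) = ∑ i, if i ∈ F then 1 else 0 := by simp
  refine le_trans ?_ ((Nat.cast_le (α := ℝ)).2 hcard)
  rw [hsum]
  refine Finset.sum_le_sum fun i _ => ?_
  have hnonneg : ∀ j ∈ Finset.univ.filter (fun j => j ≠ i ∧ ¬ Disjoint (K i) (K j)),
      (0 : ℝ) ≤ if K i ∪ K j ⊆ A then 1 else 0 := fun j _ => by split_ifs <;> norm_num
  have hs := Finset.sum_nonneg hnonneg
  by_cases hi : i ∈ F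
  · rw [if_pos hi]
    split_ifs <;> linarith
  · rw [if_neg hi]
    by_cases hKi : K i ⊆ A
    · simp only [hF, Finset.mem_filter, Finset.mem_univ, true_and, hKi, not_forall, not_not] at hi
      obtain ⟨j, hji, hd, hKj⟩ := hi
      have := Finset.single_le_sum hnonneg
        (Finset.mem_filter.2 ⟨Finset.mem_univ j, hji, hd⟩)
      rw [if_pos (Finset.union_subset hKi hKj)] at this
      rw [if_pos hKi]
      linarith
    · rw [if_neg hKi]
      linarith

open Classical in
lemma le_binExp_packing {E : Finset α} {p : ℝ} (hp₀ : 0 ≤ p) (hp₁ : p ≤ 1)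
    (hK : ∀ i, K i ⊆ E) :
    ∑ i, (p ^ (K i).card -
      ∑ j with j ≠ i ∧ ¬ Disjoint (K i) (K j), p ^ (K i ∪ K j).card) ≤
        binExp E p fun A => (packing K A : ℝ) := by
  refine le_of_eq_of_le ?_ (binExp_mono hp₀ hp₁ fun A _ => sum_sub_sum_le_packing A)
  rw [binExp_sum]
  refine Finset.sum_congr rfl fun i _ => ?_
  rw [binExp_sub, binExp_sum, binExp_ite_subset (hK i)]
  congr 1
  exact Finset.sum_congr rfl fun j _ =>
    (binExp_ite_subset (Finset.union_subset (hK i) (hK j))).symm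

end packing

section cliques

/-- The edges of the complete graph on the vertex set `W`. -/
def cliqueEdges (W : Finset V) : Finset (Sym2 V) :=
  W.offDiag.image (Function.uncurry Sym2.mk)

lemma mem_cliqueEdges {W : Finset V} {a b : V} :
    s(a, b) ∈ cliqueEdges W ↔ a ∈ W ∧ b ∈ W ∧ a ≠ b := by
  simp only [cliqueEdges, Finset.mem_image, Finset.mem_offDiag, Prod.exists,
    Function.uncurry_apply_pair, Sym2.eq_iff]
  constructor
  · rintro ⟨x, y, ⟨hx, hy, hxy⟩, ⟨rfl, rfl⟩ | ⟨rfl, rfl⟩⟩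
    · exact ⟨hx, hy, hxy⟩
    · exact ⟨hy, hx, hxy.symm⟩
  · rintro ⟨ha, hb, hab⟩
    exact ⟨a, b, ⟨ha, hb, hab⟩, Or.inl ⟨rfl, rfl⟩⟩

lemma card_cliqueEdges (W : Finset V) : (cliqueEdges W).card = W.card.choose 2 :=
  Sym2.card_image_offDiag W

lemma cliqueEdges_inter (W W' : Finset V) :
    cliqueEdges W ∩ cliqueEdges W' = cliqueEdges (W ∩ W') := by
  ext e
  induction e with
  | _ a b => simp only [Finset.mem_inter, mem_cliqueEdges]; tauto

variable {n k q : ℕ}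

/-- The vertex of `T_{n,k}` in class `i` with index `a` inside its class. -/
def classVertex (hq : q * k ≤ n) (i : Fin k) (a : Fin q) : Fin n :=
  ⟨a * k + i, by
    have : (a + 1 : ℕ) * k ≤ q * k := Nat.mul_le_mul_right k a.2
    have := i.2
    rw [add_mul] at *
    omega⟩

lemma classVertex_mod (hq : q * k ≤ n) (i : Fin k) (a : Fin q) :
    (classVertex hq i a).val % k = i := by
  simp [classVertex, Nat.mod_eq_of_lt i.2]

lemma classVertex_inj {hq : q * k ≤ n} {i j : Fin k} {a b : Fin q}
    (h : classVertex hq i a = classVertex hq j b) : i = j ∧ a = b := by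
  have hij : i = j := by
    have := congrArg (fun v : Fin n => v.val % k) h
    simp only [classVertex_mod] at this
    exact Fin.ext this
  subst hij
  refine ⟨rfl, Fin.ext ?_⟩
  have := congrArg Fin.val h
  simp only [classVertex, add_left_inj] at this
  exact Nat.eq_of_mul_eq_mul_right (Fin.pos i) this

/-- The vertices chosen by a transversal `c` of the classes. -/
def transversal (hq : q * k ≤ n) (c : Fin k → Fin q) : Finset (Fin n) :=
  Finset.univ.image fun i => classVertex hq i (c i)

lemma card_transversal (hq : q * k ≤ n) (c : Fin k → Fin q) : (transversal hq c).card = k := by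
  rw [transversal, Finset.card_image_of_injective _ fun i j h => (classVertex_inj h).1]
  simp

lemma card_transversal_inter (hq : q * k ≤ n) (c c' : Fin k → Fin q) :
    (transversal hq c ∩ transversal hq c').card = (Finset.univ.filter fun i => c' i = c i).card := by
  rw [← Finset.card_image_of_injective (Finset.univ.filter fun i => c' i = c i)
    (f := fun i => classVertex hq i (c i)) fun i j h => (classVertex_inj h).1]
  congr 1
  ext v
  simp only [transversal, Finset.mem_inter, Finset.mem_image, Finset.mem_univ, true_and,
    Finset.mem_filter]
  constructor
  · rintro ⟨⟨i, rfl⟩, j, h⟩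
    obtain ⟨rfl, h⟩ := classVertex_inj h
    exact ⟨_, h, rfl⟩
  · rintro ⟨i, h, rfl⟩
    exact ⟨⟨i, rfl⟩, i, by rw [h]⟩

lemma cliqueEdges_transversal_subset (hq : q * k ≤ n) (c : Fin k → Fin q) :
    cliqueEdges (transversal hq c) ⊆ turanEdges n k := by
  intro e
  induction e with
  | _ a b =>
    simp only [mem_cliqueEdges, transversal, Finset.mem_image, Finset.mem_univ, true_and,
      turanEdges, Finset.mem_filter, Sym2.map_mk, Sym2.mk_isDiag_iff]
    rintro ⟨⟨i, rfl⟩, ⟨j, rfl⟩, h⟩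
    rw [classVertex_mod, classVertex_mod]
    exact fun hij => h (by rw [Fin.ext hij])

lemma goodCopy_of_cliqueEdges_subset {hq : q * k ≤ n} {c : Fin k → Fin q}
    {A : Finset (Sym2 (Fin n))} (h : cliqueEdges (transversal hq c) ⊆ A) : GoodCopy n k A := by
  refine ⟨fun i => classVertex hq i (c i), fun i j h => (classVertex_inj h).1,
    fun i j hij => ?_, fun i j hij => h ?_⟩
  · simp only [classVertex_mod]
    exact fun h => hij (Fin.ext h)
  · rw [mem_cliqueEdges]
    exact ⟨Finset.mem_image_of_mem _ (Finset.mem_univ i),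
      Finset.mem_image_of_mem _ (Finset.mem_univ j), fun h => hij (classVertex_inj h).1⟩

lemma card_turanEdges_le (n k : ℕ) : (turanEdges n k).card ≤ n ^ 2 := by
  refine (Finset.card_le_univ _).trans ?_
  rw [Sym2.card, Fintype.card_fin, Nat.choose_two_right, Nat.add_sub_cancel]
  refine Nat.div_le_of_le_mul ?_
  nlinarith [Nat.le_self_pow two_ne_zero n]

lemma sq_le_card_turanEdges (hk : 2 ≤ k) (hq : q * k ≤ n) : q ^ 2 ≤ (turanEdges n k).card := by
  have h01 : (⟨0, by omega⟩ : Fin k) ≠ ⟨1, by omega⟩ := by simp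
  have hcard : q ^ 2 = (Finset.univ : Finset (Fin q × Fin q)).card := by simp [sq]
  rw [hcard]
  refine Finset.card_le_card_of_injOn
    (fun x => s(classVertex hq ⟨0, by omega⟩ x.1, classVertex hq ⟨1, by omega⟩ x.2))
    (fun x _ => ?_) fun x _ y _ h => ?_
  · simp [turanEdges, classVertex_mod]
  · rcases Sym2.eq_iff.1 h with ⟨h₁, h₂⟩ | ⟨h₁, -⟩
    · exact Prod.ext (classVertex_inj h₁).2 (classVertex_inj h₂).2
    · exact absurd (classVertex_inj h₁).1 h01

lemma card_filter_agree (c : Fin k → Fin q) (S : Finset (Fin k)) :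
    (Finset.univ.filter fun c' : Fin k → Fin q => ∀ i ∈ S, c' i = c i).card =
      q ^ (k - S.card) := by
  have : (Finset.univ.filter fun c' : Fin k → Fin q => ∀ i ∈ S, c' i = c i) =
      Fintype.piFinset fun i => if i ∈ S then {c i} else Finset.univ := by
    ext c'
    simp only [Finset.mem_filter, Finset.mem_univ, true_and, Fintype.mem_piFinset]
    refine forall_congr' fun i => ?_
    split_ifs with h <;> simp [h]
  rw [this, Fintype.card_piFinset]
  simp only [apply_ite Finset.card, Finset.card_singleton, Finset.card_univ, Fintype.card_fin]
  rw [Finset.prod_ite, Finset.prod_const_one, one_mul, Finset.prod_const]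
  congr 1
  rw [← Finset.compl_filter, Finset.card_compl, Fintype.card_fin]
  simp

open Classical in
/-- Few transversals span a clique sharing an edge with a given one. -/
lemma sum_overlapping_le {p β : ℝ} (hp₀ : 0 ≤ p) (hβ : 0 ≤ β) (hq : q * k ≤ n)
    (hp : ∀ s, 2 ≤ s → s < k →
      (q : ℝ) ^ (k - s) * p ^ (k.choose 2 - s.choose 2) ≤ β) (c : Fin k → Fin q) :
    ∑ c' with c' ≠ c ∧ ¬ Disjoint (cliqueEdges (transversal hq c))
        (cliqueEdges (transversal hq c')),
      p ^ (cliqueEdges (transversal hq c) ∪ cliqueEdges (transversal hq c')).card ≤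
        2 ^ k * β * p ^ k.choose 2 := by
  rw [← Finset.sum_fiberwise _ fun c' : Fin k → Fin q => Finset.univ.filter fun i => c' i = c i]
  have hbound : ∀ S : Finset (Fin k), ∑ c' ∈ Finset.univ.filter (fun c' => c' ≠ c ∧
        ¬ Disjoint (cliqueEdges (transversal hq c)) (cliqueEdges (transversal hq c')))
        with (Finset.univ.filter fun i => c' i = c i) = S,
      p ^ (cliqueEdges (transversal hq c) ∪ cliqueEdges (transversal hq c')).card ≤
        β * p ^ k.choose 2 := by
    intro S
    set T := (Finset.univ.filter (fun c' => c' ≠ c ∧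
      ¬ Disjoint (cliqueEdges (transversal hq c)) (cliqueEdges (transversal hq c')))).filter
        (fun c' => (Finset.univ.filter fun i => c' i = c i) = S) with hT
    rcases T.eq_empty_or_nonempty with hempty | ⟨c₀, hc₀⟩
    · rw [hempty, Finset.sum_empty]
      positivity
    · have hinter : ∀ c' ∈ T, (transversal hq c ∩ transversal hq c').card = S.card := by
        intro c' hc'
        rw [card_transversal_inter, (Finset.mem_filter.1 hc').2]
      have hS₂ : 2 ≤ S.card := by
        have hd := (Finset.mem_filter.1 (Finset.mem_filter.1 hc₀).1).2.2
        rw [Finset.not_disjoint_iff_nonempty_inter, cliqueEdges_inter, ← Finset.card_pos,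
          card_cliqueEdges, hinter c₀ hc₀] at hd
        by_contra! hlt
        rw [Nat.choose_eq_zero_of_lt hlt] at hd
        exact hd.false
      have hSk : S.card < k := by
        have hne := (Finset.mem_filter.1 (Finset.mem_filter.1 hc₀).1).2.1
        refine lt_of_le_of_ne ((Finset.card_le_univ S).trans_eq (Fintype.card_fin k))
          fun h => hne ?_
        have hS : S = Finset.univ := Finset.eq_univ_of_card S (h.trans (Fintype.card_fin k).symm)
        have := (Finset.mem_filter.1 hc₀).2
        refine funext fun i => ?_
        have hi := Finset.mem_univ i
        rw [← hS, ← this] at hi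
        exact (Finset.mem_filter.1 hi).2
      have hle : S.card.choose 2 ≤ k.choose 2 := Nat.choose_le_choose 2 hSk.le
      have hterm : ∀ c' ∈ T,
          p ^ (cliqueEdges (transversal hq c) ∪ cliqueEdges (transversal hq c')).card =
            p ^ (k.choose 2 - S.card.choose 2) * p ^ k.choose 2 := by
        intro c' hc'
        have := Finset.card_union_add_card_inter (cliqueEdges (transversal hq c))
          (cliqueEdges (transversal hq c'))
        rw [cliqueEdges_inter, card_cliqueEdges, card_cliqueEdges, card_cliqueEdges,
          hinter c' hc', card_transversal, card_transversal] at this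
        rw [← pow_add]
        congr 1
        omega
      have hcard : T.card ≤ q ^ (k - S.card) := by
        rw [← card_filter_agree c S]
        refine Finset.card_le_card fun c' hc' => Finset.mem_filter.2 ⟨Finset.mem_univ _, ?_⟩
        intro i hi
        rw [← (Finset.mem_filter.1 hc').2] at hi
        exact (Finset.mem_filter.1 hi).2
      rw [Finset.sum_congr rfl hterm, Finset.sum_const, nsmul_eq_mul, ← mul_assoc]
      refine mul_le_mul_of_nonneg_right (le_trans ?_ (hp S.card hS₂ hSk)) (by positivity)
      exact mul_le_mul_of_nonneg_right (by exact_mod_cast hcard) (by positivity)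
  refine (Finset.sum_le_sum fun S _ => hbound S).trans_eq ?_
  simp [mul_assoc]

/-- Lower bound for the expected number of edge-disjoint transversal cliques. -/
lemma le_binExp_packing_cliques {p : ℝ} (hp₀ : 0 ≤ p) (hp₁ : p ≤ 1) (hq : q * k ≤ n)
    (hp : ∀ s, 2 ≤ s → s < k →
      (q : ℝ) ^ (k - s) * p ^ (k.choose 2 - s.choose 2) ≤ 1 / 2 ^ (k + 1)) :
    (q : ℝ) ^ k * p ^ k.choose 2 / 2 ≤ binExp (turanEdges n k) p fun A =>
      (packing (fun c : Fin k → Fin q => cliqueEdges (transversal hq c)) A : ℝ) := by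
  classical
  refine le_trans ?_ (le_binExp_packing hp₀ hp₁ (cliqueEdges_transversal_subset hq))
  calc (q : ℝ) ^ k * p ^ k.choose 2 / 2
      = ∑ _c : Fin k → Fin q,
          (p ^ k.choose 2 - 2 ^ k * (1 / 2 ^ (k + 1)) * p ^ k.choose 2) := by
        rw [show (2 : ℝ) ^ k * (1 / 2 ^ (k + 1)) = 1 / 2 by rw [pow_succ]; field_simp]
        simp only [Finset.sum_const, Finset.card_univ, Fintype.card_fun, Fintype.card_fin,
          nsmul_eq_mul, Nat.cast_pow]
        ring
    _ ≤ _ := by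
        refine Finset.sum_le_sum fun c _ => ?_
        rw [card_cliqueEdges, card_transversal]
        refine sub_le_sub_left ?_ _
        refine le_of_eq_of_le ?_ (sum_overlapping_le hp₀ (by positivity) hq hp c)
        congr!

end cliques

section threshold

variable {n k : ℕ}

lemma cast_choose_two_mul_two (m : ℕ) : (m.choose 2 : ℝ) * 2 = m * (m - 1) := by
  rw [Nat.cast_choose_two]
  ring

lemma pow_mul_rpow_pow_le_one (hn : 1 ≤ n) {s : ℕ} (hs : 2 ≤ s) (hsk : s < k) :
    (n : ℝ) ^ (k - s) * ((n : ℝ) ^ (-(2 / (k + 1 : ℝ)))) ^ (k.choose 2 - s.choose 2) ≤ 1 := by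
  have hn₁ : (1 : ℝ) ≤ n := by exact_mod_cast hn
  have hn₀ : (0 : ℝ) < n := by linarith
  have hk : (0 : ℝ) < k + 1 := by positivity
  rw [← Real.rpow_natCast, ← Real.rpow_natCast, ← Real.rpow_mul hn₀.le, ← Real.rpow_add hn₀]
  refine Real.rpow_le_one_of_one_le_of_nonpos hn₁ ?_
  rw [Nat.cast_sub hsk.le, Nat.cast_sub (Nat.choose_le_choose 2 hsk.le)]
  have h₁ := cast_choose_two_mul_two k
  have h₂ := cast_choose_two_mul_two s
  have hs' : (2 : ℝ) ≤ s := by exact_mod_cast hs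
  have hsk' : (s : ℝ) < k := by exact_mod_cast hsk
  rw [neg_mul, ← sub_eq_add_neg, sub_nonpos, div_mul_eq_mul_div, le_div_iff₀ hk]
  nlinarith

lemma pow_mul_rpow_pow_choose_two (hn : 1 ≤ n) :
    (n : ℝ) ^ k * ((n : ℝ) ^ (-(2 / (k + 1 : ℝ)))) ^ k.choose 2 =
      (n : ℝ) ^ (2 - 2 / (k + 1 : ℝ)) := by
  have hn₀ : (0 : ℝ) < n := by exact_mod_cast hn
  have hk : (k + 1 : ℝ) ≠ 0 := by positivity
  rw [← Real.rpow_natCast, ← Real.rpow_natCast, ← Real.rpow_mul hn₀.le, ← Real.rpow_add hn₀]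
  congr 1
  have h₁ := cast_choose_two_mul_two k
  field_simp
  linarith

lemma div_le_cast_div (hk : 0 < k) (hn : 2 * k ≤ n) :
    (n : ℝ) / (2 * k) ≤ ((n / k : ℕ) : ℝ) := by
  have h₁ : n < (n / k + 1) * k := by
    rw [add_mul, one_mul]
    exact Nat.lt_div_mul_add hk
  have h₁' : (n : ℝ) < (((n / k : ℕ) : ℝ) + 1) * k := by exact_mod_cast h₁
  have h₂ : (2 : ℝ) * k ≤ n := by exact_mod_cast hn
  rw [div_le_iff₀ (by positivity)]
  nlinarith

/-- The binomial density `p = 2^{-(k+1)} n^{-2/(k+1)}` makes the packing of transversal cliques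
linear in `n^{2-2/(k+1)}` with probability tending to one. -/
lemma uniformProb_packing_le (hk : 3 ≤ k) {γ x : ℝ}
    (hγ : γ = (1 / 2 ^ (k + 1)) ^ k.choose 2 / (2 * k) ^ k / 2)
    (hx : x = (n : ℝ) ^ (2 - 2 / (k + 1 : ℝ))) (hx₁ : 1 ≤ x) (hn : 2 * k ≤ n)
    (hM : 2 * ⌊x⌋₊ ≤ (turanEdges n k).card) :
    uniformProb (turanEdges n k) (2 * ⌊x⌋₊)
      (fun A => (packing (fun c : Fin k → Fin (n / k) =>
        cliqueEdges (transversal (Nat.div_mul_le_self n k) c)) A : ℝ) ≤ γ * x / 2) ≤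
      8 / γ ^ 2 / x := by
  have hn₁ : 1 ≤ n := by omega
  have hn₀ : (0 : ℝ) < n := by exact_mod_cast hn₁
  have hn₁' : (1 : ℝ) ≤ n := by exact_mod_cast hn₁
  have hx₀ : 0 < x := by linarith
  have hk₀ : (0 : ℝ) < k := by exact_mod_cast (by omega : 0 < k)
  set β : ℝ := 1 / 2 ^ (k + 1) with hβ
  set t : ℝ := (n : ℝ) ^ (-(2 / (k + 1 : ℝ))) with ht
  have hβ₀ : 0 < β := by positivity
  have hβ₁ : β ≤ 1 / 2 := by
    rw [hβ]
    refine one_div_le_one_div_of_le two_pos ?_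
    exact le_self_pow₀ one_le_two (Nat.succ_ne_zero k)
  have ht₀ : 0 < t := Real.rpow_pos_of_pos hn₀ _
  have ht₁ : t ≤ 1 := Real.rpow_le_one_of_one_le_of_nonpos hn₁' (by
    rw [neg_nonpos]; positivity)
  have hγ₀ : 0 < γ := by rw [hγ]; positivity
  have hp₀ : 0 ≤ β * t := by positivity
  have hp₁ : β * t ≤ 1 := by nlinarith
  have hq : ((n / k : ℕ) : ℝ) ≤ n := by exact_mod_cast Nat.div_le_self n k
  have hcond : ∀ s, 2 ≤ s → s < k →
      ((n / k : ℕ) : ℝ) ^ (k - s) * (β * t) ^ (k.choose 2 - s.choose 2) ≤ β := by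
    intro s hs hsk
    have hm : k.choose 2 - s.choose 2 ≠ 0 := by
      have h₁ : (s + 1).choose 2 ≤ k.choose 2 := Nat.choose_le_choose 2 hsk
      have h₂ : (s + 1).choose 2 = s.choose 1 + s.choose 2 := Nat.choose_succ_succ' s 1
      rw [Nat.choose_one_right] at h₂
      omega
    calc ((n / k : ℕ) : ℝ) ^ (k - s) * (β * t) ^ (k.choose 2 - s.choose 2)
        ≤ (n : ℝ) ^ (k - s) * (β * t ^ (k.choose 2 - s.choose 2)) := by
          rw [mul_pow]
          gcongr
          exact pow_le_of_le_one hβ₀.le (by linarith) hm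
      _ = β * ((n : ℝ) ^ (k - s) * t ^ (k.choose 2 - s.choose 2)) := by ring
      _ ≤ β * 1 := mul_le_mul_of_nonneg_left (pow_mul_rpow_pow_le_one hn₁ hs hsk) hβ₀.le
      _ = β := mul_one β
  have hexp := le_binExp_packing_cliques hp₀ hp₁ (Nat.div_mul_le_self n k) hcond
  clear_value β
  have hmean : γ * x ≤ ((n / k : ℕ) : ℝ) ^ k * (β * t) ^ k.choose 2 / 2 := by
    rw [hx, ← pow_mul_rpow_pow_choose_two hn₁, ← ht, hγ]
    have := pow_le_pow_left₀ (by positivity) (div_le_cast_div (by omega) hn) k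
    calc β ^ k.choose 2 / (2 * k) ^ k / 2 * ((n : ℝ) ^ k * t ^ k.choose 2)
        = (n / (2 * k) : ℝ) ^ k * (β * t) ^ k.choose 2 / 2 := by
          rw [div_pow (n : ℝ), mul_pow β t]
          generalize (2 * k : ℝ) ^ k = c
          ring
      _ ≤ _ := by gcongr
  have hNp : (turanEdges n k).card * (β * t) ≤ β * x := by
    have hxt : x = (n : ℝ) ^ 2 * t := by
      rw [hx, ht, ← Real.rpow_natCast, ← Real.rpow_add hn₀]
      congr 1
    have : ((turanEdges n k).card : ℝ) ≤ (n : ℝ) ^ 2 := by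
      exact_mod_cast card_turanEdges_le n k
    calc (turanEdges n k).card * (β * t) ≤ (n : ℝ) ^ 2 * (β * t) := by gcongr
      _ = β * x := by rw [hxt]; ring
  have hfloor₁ : 1 ≤ ⌊x⌋₊ := (Nat.one_le_floor_iff x).2 hx₁
  have hfloor : x / 2 ≤ (⌊x⌋₊ : ℝ) := by
    have h₁ := Nat.lt_floor_add_one x
    have h₂ : (1 : ℝ) ≤ ⌊x⌋₊ := by exact_mod_cast hfloor₁
    linarith
  have htail := edgeProb_le_half_le hp₀ hp₁ abs_packing_insert_sub_le
    (mul_pos hγ₀ hx₀) (hmean.trans hexp)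
  refine (uniformProb_le_two_mul_edgeProb hp₀ hp₁ (by omega) hM ?_ ?_).trans
    ((mul_le_mul_of_nonneg_left htail zero_le_two).trans ?_)
  · push_cast
    nlinarith
  · intro A A' hA h
    exact le_trans (by exact_mod_cast packing_mono hA) h
  · have hNp' : (turanEdges n k).card * (β * t) ≤ x := hNp.trans (by nlinarith)
    calc 2 * (4 * ((turanEdges n k).card * (β * t)) / (γ * x) ^ 2)
        ≤ 2 * (4 * x / (γ * x) ^ 2) :=
          mul_le_mul_of_nonneg_left (div_le_div_of_nonneg_right
            (mul_le_mul_of_nonneg_left hNp' (by norm_num)) (by positivity)) zero_le_two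
      _ = 8 / γ ^ 2 / x := by field_simp; norm_num

end threshold

/-- For `M = 2⌊n^{2-2/(k+1)}⌋`, a.a.s. every subgraph of
`G ∼ G(T_{n,k}, M)` with at least `⌊(1-δ)M⌋` edges contains a good copy of `K_k`. -/
theorem resilient_good_copy (k : ℕ) (hk : 3 ≤ k) :
    ∃ δ : ℝ, 0 < δ ∧
      Filter.Tendsto (fun n : ℕ =>
          uniformProb (turanEdges n k) (2 * ⌊(n : ℝ) ^ (2 - 2 / (k + 1 : ℝ))⌋₊)
            (fun A => ∀ A' ⊆ A,
              ⌊(1 - δ) * ((2 * ⌊(n : ℝ) ^ (2 - 2 / (k + 1 : ℝ))⌋₊ : ℕ) : ℝ)⌋₊ ≤ A'.card →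
              GoodCopy n k A'))
        Filter.atTop (nhds 1) := by
  set γ : ℝ := (1 / 2 ^ (k + 1)) ^ k.choose 2 / (2 * k) ^ k / 2 with hγ
  have hk₀ : (0 : ℝ) < k := by exact_mod_cast (by omega : 0 < k)
  have hγ₀ : 0 < γ := by positivity
  refine ⟨γ / 8, by positivity, ?_⟩
  have hexp : (2 : ℝ) / (k + 1) ≤ 1 := by
    rw [div_le_one (by positivity)]
    linarith [show (3 : ℝ) ≤ k by exact_mod_cast hk]
  have hxtop : Filter.Tendsto (fun n : ℕ => (n : ℝ) ^ (2 - 2 / (k + 1 : ℝ)))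
      Filter.atTop Filter.atTop :=
    (tendsto_rpow_atTop (by linarith)).comp tendsto_natCast_atTop_atTop
  have hlow : Filter.Tendsto
      (fun n : ℕ => 1 - 8 / γ ^ 2 / (n : ℝ) ^ (2 - 2 / (k + 1 : ℝ))) Filter.atTop (nhds 1) := by
    simpa using tendsto_const_nhds.sub (hxtop.const_div_atTop (8 / γ ^ 2))
  have ht : Filter.Tendsto (fun n : ℕ => (n : ℝ) ^ (-(2 / (k + 1 : ℝ))))
      Filter.atTop (nhds 0) :=
    (tendsto_rpow_neg_atTop (by positivity)).comp tendsto_natCast_atTop_atTop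
  refine tendsto_of_tendsto_of_tendsto_of_le_of_le' hlow tendsto_const_nhds ?_
    (Filter.Eventually.of_forall fun n => uniformProb_le_one _)
  filter_upwards [hxtop.eventually_ge_atTop 1, hxtop.eventually_ge_atTop (4 / γ),
    Filter.eventually_ge_atTop (2 * k),
    ht.eventually (ge_mem_nhds (show (0 : ℝ) < 1 / (8 * k ^ 2) by positivity))]
    with n hx₁ hx₂ hn htn
  set x : ℝ := (n : ℝ) ^ (2 - 2 / (k + 1 : ℝ)) with hx
  have hx₀ : 0 < x := by linarith
  have hn₀ : (0 : ℝ) < n := by exact_mod_cast (by omega : 0 < n)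
  have hfloor : (⌊x⌋₊ : ℝ) ≤ x := Nat.floor_le hx₀.le
  have hM : 2 * ⌊x⌋₊ ≤ (turanEdges n k).card := by
    refine le_trans ?_ (sq_le_card_turanEdges (by omega) (Nat.div_mul_le_self n k))
    have hxt : x = (n : ℝ) ^ 2 * (n : ℝ) ^ (-(2 / (k + 1 : ℝ))) := by
      rw [hx, ← Real.rpow_natCast, ← Real.rpow_add hn₀]
      congr 1
    have h₁ : 2 * x ≤ ((n / k : ℕ) : ℝ) ^ 2 := by
      calc 2 * x ≤ 2 * ((n : ℝ) ^ 2 * (1 / (8 * k ^ 2))) := by rw [hxt]; gcongr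
        _ = (n / (2 * k) : ℝ) ^ 2 := by field_simp; ring
        _ ≤ _ := by gcongr; exact div_le_cast_div (by omega) hn
    have h₂ : ((2 * ⌊x⌋₊ : ℕ) : ℝ) ≤ ((n / k : ℕ) : ℝ) ^ 2 := by
      push_cast
      linarith
    exact_mod_cast h₂
  refine (sub_le_sub_left (uniformProb_packing_le hk hγ hx hx₁ hn hM) 1).trans
    (one_sub_uniformProb_le hM fun A _ hAM hA A' hA' hcard => ?_)
  obtain ⟨c, hc⟩ : ∃ c, cliqueEdges (transversal (Nat.div_mul_le_self n k) c) ⊆ A' := by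
    refine exists_subset_of_card_sdiff_lt_packing (A := A) ?_
    rw [not_le] at hA
    have h₁ : (((A \ A').card : ℕ) : ℝ) = (2 * ⌊x⌋₊ : ℕ) - A'.card := by
      rw [Finset.card_sdiff_of_subset hA', Nat.cast_sub (Finset.card_le_card hA'), hAM]
    have h₂ := Nat.lt_of_floor_lt (Nat.lt_succ_of_le hcard)
    rw [← Nat.cast_lt (α := ℝ), h₁]
    refine lt_of_le_of_lt ?_ hA
    rw [div_le_iff₀ hγ₀] at hx₂
    push_cast at h₂ ⊢
    nlinarith
  exact goodCopy_of_cliqueEdges_subset hc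

end TournamentGame
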